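/- The concept language L(∀,∃,≥,⊓,⊤) admits finite characterisations: for all finite signatures Σ_C, Σ_R, every concept C ∈ L(∀,∃,≥,⊓,⊤)[Σ_C,Σ_R] has a finite characterisation w.r.t. L(∀,∃,≥,⊓,⊤)[Σ_C,Σ_R]. -/

import Mathlib

namespace DL

/-! ### Syntax of ALCQI concepts -/

/-- Roles: role names (indexed by ℕ) and inverse roles. -/
inductive Role where
  | name : ℕ → Role
  | inv  : ℕ → Role
deriving DecidableEq

/-- ALCQI concept expressions. -/
inductive Concept where
  | atom : ℕ → Concept
  | top  : Concept
  | bot  : Concept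
  | and  : Concept → Concept → Concept
  | or   : Concept → Concept → Concept
  | neg  : Concept → Concept
  | ex   : Role → Concept → Concept
  | all  : Role → Concept → Concept
  | atLeast : ℕ → Role → Concept → Concept
deriving DecidableEq

/-- The operators/constructors that a concept language may use. -/
inductive Op where
  | all | ex | ge | inv | and | or | top | bot | neg
deriving DecidableEq

/-! ### Interpretations and semantics -/

/-- An interpretation: a nonempty domain, interpretations of concept names
and of role names. -/
structure Interp where
  Δ : Type
  dom_nonempty : Nonempty Δ
  atom : ℕ → Set Δ
  rel : ℕ → Δ → Δ → Prop

def Role.sem (I : Interp) : Role → (I.Δ → I.Δ → Prop)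
  | .name R => I.rel R
  | .inv R  => fun d e => I.rel R e d

def Concept.sem (I : Interp) : Concept → Set I.Δ
  | .atom A => I.atom A
  | .top => Set.univ
  | .bot => ∅
  | .and C D => C.sem I ∩ D.sem I
  | .or C D => C.sem I ∪ D.sem I
  | .neg C => (C.sem I)ᶜ
  | .ex S C => {d | ∃ e, S.sem I d e ∧ e ∈ C.sem I}
  | .all S C => {d | ∀ e, S.sem I d e → e ∈ C.sem I}
  | .atLeast k S C => {d | ∃ s : Finset I.Δ, s.card = k ∧ ∀ e ∈ s, S.sem I d e ∧ e ∈ C.sem I}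

/-! ### Concept languages L(Os)[SC, SR] -/

def Role.inSig (Os : Finset Op) (SR : Finset ℕ) : Role → Prop
  | .name R => R ∈ SR
  | .inv R  => Op.inv ∈ Os ∧ R ∈ SR

/-- Membership of a concept in the language `L(Os)[SC, SR]`. -/
def Concept.inLang (Os : Finset Op) (SC SR : Finset ℕ) : Concept → Prop
  | .atom A => A ∈ SC
  | .top => Op.top ∈ Os
  | .bot => Op.bot ∈ Os
  | .and C D => Op.and ∈ Os ∧ C.inLang Os SC SR ∧ D.inLang Os SC SR
  | .or C D => Op.or ∈ Os ∧ C.inLang Os SC SR ∧ D.inLang Os SC SR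
  | .neg C => Op.neg ∈ Os ∧ C.inLang Os SC SR
  | .ex S C => Op.ex ∈ Os ∧ S.inSig Os SR ∧ C.inLang Os SC SR
  | .all S C => Op.all ∈ Os ∧ S.inSig Os SR ∧ C.inLang Os SC SR
  | .atLeast k S C => Op.ge ∈ Os ∧ 1 ≤ k ∧ S.inSig Os SR ∧ C.inLang Os SC SR

/-! ### DL-Lite ontologies -/

/-- Basic concepts: concept names, ∃R and ∃R⁻. -/
inductive Basic where
  | atom : ℕ → Basic
  | ex : Role → Basic
deriving DecidableEq

def Basic.sem (I : Interp) : Basic → Set I.Δ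
  | .atom A => I.atom A
  | .ex S => {d | ∃ e, S.sem I d e}

/-- A DL-Lite concept inclusion `B ⊑ C` where `C` is a basic concept
(`negated = false`) or a negated basic concept (`negated = true`). -/
structure CI where
  lhs : Basic
  rhs : Basic
  negated : Bool
deriving DecidableEq

def CI.sat (I : Interp) (ci : CI) : Prop :=
  if ci.negated then ci.lhs.sem I ⊆ (ci.rhs.sem I)ᶜ else ci.lhs.sem I ⊆ ci.rhs.sem I

/-- A DL-Lite ontology: a finite set (list) of concept inclusions. -/
abbrev Ontology := List CI

def Interp.satO (I : Interp) (Ont : Ontology) : Prop := ∀ ci ∈ Ont, ci.sat I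

/-! ### Pointed interpretations, examples, characterisations -/

structure PInterp where
  I : Interp
  pt : I.Δ

/-- A pointed interpretation is finite if its domain is finite. -/
def PInterp.finite (P : PInterp) : Prop := Finite P.I.Δ

/-- `C` fits a collection `(Epos, Eneg)` of labelled examples. -/
def Fits (C : Concept) (Epos Eneg : List PInterp) : Prop :=
  (∀ e ∈ Epos, e.pt ∈ C.sem e.I) ∧ (∀ e ∈ Eneg, e.pt ∉ C.sem e.I)

/-- Equivalence of concepts. -/
def CEquiv (C D : Concept) : Prop := ∀ I : Interp, C.sem I = D.sem I

/-- Equivalence of concepts relative to an ontology. -/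
def CEquivO (Ont : Ontology) (C D : Concept) : Prop :=
  ∀ I : Interp, I.satO Ont → C.sem I = D.sem I

/-- `⊨ C ⊑ D`. -/
def Subsumes (C D : Concept) : Prop := ∀ I : Interp, C.sem I ⊆ D.sem I

/-- `Ont ⊨ C ⊑ D`. -/
def SubsumesO (Ont : Ontology) (C D : Concept) : Prop :=
  ∀ I : Interp, I.satO Ont → C.sem I ⊆ D.sem I

/-- `(Epos, Eneg)` is a finite characterisation of `C` w.r.t. the
concept language (predicate) `L`: all examples are finite, `C` fits,
and every fitting concept of `L` is equivalent to `C`. -/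
def FinChar (L : Concept → Prop) (C : Concept) (Epos Eneg : List PInterp) : Prop :=
  (∀ e ∈ Epos ++ Eneg, e.finite) ∧
  Fits C Epos Eneg ∧
  ∀ D, L D → Fits D Epos Eneg → CEquiv C D

/-- Finite characterisation of `C` w.r.t. `L` under an ontology `Ont`:
all examples are finite and satisfy `Ont`, `C` fits, and every fitting
concept of `L` is equivalent to `C` relative to `Ont`. -/
def FinCharO (Ont : Ontology) (L : Concept → Prop) (C : Concept)
    (Epos Eneg : List PInterp) : Prop :=
  (∀ e ∈ Epos ++ Eneg, e.finite ∧ e.I.satO Ont) ∧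
  Fits C Epos Eneg ∧
  ∀ D, L D → Fits D Epos Eneg → CEquivO Ont C D

/-- `L(Os)` admits finite characterisations. -/
def AdmitsFinChar (Os : Finset Op) : Prop :=
  ∀ SC SR : Finset ℕ, ∀ C : Concept, C.inLang Os SC SR →
    ∃ Epos Eneg : List PInterp, FinChar (Concept.inLang Os SC SR) C Epos Eneg

/-- `L(Os)` admits finite characterisations under the ontology `Ont`. -/
def AdmitsFinCharO (Os : Finset Op) (Ont : Ontology) : Prop :=
  ∀ SC SR : Finset ℕ, ∀ C : Concept, C.inLang Os SC SR →
    ∃ Epos Eneg : List PInterp, FinCharO Ont (Concept.inLang Os SC SR) C Epos Eneg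

/-! ### Size, role depth, number restrictions -/

/-- Number of symbols of a concept expression (numbers in binary). -/
def Concept.size : Concept → ℕ
  | .atom _ => 1
  | .top => 1
  | .bot => 1
  | .and C D => C.size + D.size + 1
  | .or C D => C.size + D.size + 1
  | .neg C => C.size + 1
  | .ex _ C => C.size + 2
  | .all _ C => C.size + 2
  | .atLeast k _ C => C.size + 2 + Nat.size k

/-- Role depth of a concept. -/
def Concept.dp : Concept → ℕ
  | .atom _ => 0
  | .top => 0
  | .bot => 0
  | .and C D => max C.dp D.dp
  | .or C D => max C.dp D.dp
  | .neg C => C.dp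
  | .ex _ C => C.dp + 1
  | .all _ C => C.dp + 1
  | .atLeast _ _ C => C.dp + 1

/-- The largest number occurring in a number restriction of `C` (0 if none). -/
def Concept.nr : Concept → ℕ
  | .atom _ => 0
  | .top => 0
  | .bot => 0
  | .and C D => max C.nr D.nr
  | .or C D => max C.nr D.nr
  | .neg C => C.nr
  | .ex _ C => C.nr
  | .all _ C => C.nr
  | .atLeast k _ C => max k C.nr

/-- The operators of the language `L(∀,∃,≥,⊓,⊤)`. -/
abbrev aleqOps : Finset Op := {Op.all, Op.ex, Op.ge, Op.and, Op.top}

section Language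

variable {SC SR : Finset ℕ}

/-- Induction principle for the concepts of `L(∀,∃,≥,⊓,⊤)[SC, SR]`. -/
theorem Concept.inLang_induction {P : Concept → Prop}
    (atom : ∀ A, A ∈ SC → P (.atom A)) (top : P .top)
    (and : ∀ C D, C.inLang aleqOps SC SR → D.inLang aleqOps SC SR → P C → P D → P (.and C D))
    (ex : ∀ R C, R ∈ SR → C.inLang aleqOps SC SR → P C → P (.ex (.name R) C))
    (all : ∀ R C, R ∈ SR → C.inLang aleqOps SC SR → P C → P (.all (.name R) C))
    (atLeast : ∀ k R C, 1 ≤ k → R ∈ SR → C.inLang aleqOps SC SR → P C →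
      P (.atLeast k (.name R) C))
    (C : Concept) (hC : C.inLang aleqOps SC SR) : P C := by
  induction C with
  | atom A => exact atom A hC
  | top => exact top
  | bot => simp [Concept.inLang] at hC
  | or => simp [Concept.inLang] at hC
  | neg => simp [Concept.inLang] at hC
  | and C D ihC ihD => exact and C D hC.2.1 hC.2.2 (ihC hC.2.1) (ihD hC.2.2)
  | ex S C ih =>
    cases S with
    | name R => exact ex R C hC.2.1 hC.2.2 (ih hC.2.2)
    | inv R => simp [Concept.inLang, Role.inSig] at hC
  | all S C ih =>
    cases S with
    | name R => exact all R C hC.2.1 hC.2.2 (ih hC.2.2)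
    | inv R => simp [Concept.inLang, Role.inSig] at hC
  | atLeast k S C ih =>
    cases S with
    | name R => exact atLeast k R C hC.2.1 hC.2.2.1 hC.2.2.2 (ih hC.2.2.2)
    | inv R => simp [Concept.inLang, Role.inSig] at hC

end Language

/-- The conjunction of all `D` such that `∀R.D` is a top-level conjunct of the concept. -/
def Concept.forallPart (R : ℕ) : Concept → Concept
  | .and C D => .and (C.forallPart R) (D.forallPart R)
  | .all S C => if S = .name R then C else .top
  | _ => .top

/-- The set of all `D` such that `∃R.D` or some `≥ k R.D` is a top-level conjunct of the
concept. -/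
def Concept.existsParts (R : ℕ) : Concept → Set Concept
  | .and C D => C.existsParts R ∪ D.existsParts R
  | .ex S C => {D | S = .name R ∧ D = C}
  | .atLeast _ S C => {D | S = .name R ∧ D = C}
  | _ => ∅

theorem Concept.forallPart_bounds {SC SR : Finset ℕ} {n N : ℕ} (R : ℕ) {C : Concept}
    (hC : C.inLang aleqOps SC SR) (hdp : C.dp ≤ n + 1) (hnr : C.nr ≤ N) :
    (C.forallPart R).inLang aleqOps SC SR ∧ (C.forallPart R).dp ≤ n ∧
      (C.forallPart R).nr ≤ N := by
  induction C with
  | and C D ihC ihD =>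
    simp only [Concept.dp, Concept.nr, max_le_iff] at hdp hnr
    obtain ⟨hC₁, hC₂, hC₃⟩ := ihC hC.2.1 hdp.1 hnr.1
    obtain ⟨hD₁, hD₂, hD₃⟩ := ihD hC.2.2 hdp.2 hnr.2
    exact ⟨⟨hC.1, hC₁, hD₁⟩, max_le hC₂ hD₂, max_le hC₃ hD₃⟩
  | all S C =>
    simp only [Concept.dp, Concept.nr] at hdp hnr
    by_cases h : S = .name R
    · simpa [Concept.forallPart, h] using ⟨hC.2.2, by omega, hnr⟩
    · simp [Concept.forallPart, h, Concept.inLang, Concept.dp, Concept.nr]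
  | _ => simp [Concept.forallPart, Concept.inLang, Concept.dp, Concept.nr]

theorem Concept.existsParts_bounds {SC SR : Finset ℕ} {n N : ℕ} {R : ℕ} {C D : Concept}
    (hC : C.inLang aleqOps SC SR) (hdp : C.dp ≤ n + 1) (hnr : C.nr ≤ N)
    (hD : D ∈ C.existsParts R) :
    D.inLang aleqOps SC SR ∧ D.dp ≤ n ∧ D.nr ≤ N := by
  induction C with
  | and C C' ih ih' =>
    simp only [Concept.dp, Concept.nr, max_le_iff] at hdp hnr
    exact hD.elim (ih hC.2.1 hdp.1 hnr.1) (ih' hC.2.2 hdp.2 hnr.2)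
  | ex S C =>
    obtain ⟨-, rfl⟩ := hD
    simp only [Concept.dp, Concept.nr] at hdp hnr
    exact ⟨hC.2.2, by omega, hnr⟩
  | atLeast k S C =>
    obtain ⟨-, rfl⟩ := hD
    simp only [Concept.dp, Concept.nr, max_le_iff] at hdp hnr
    exact ⟨hC.2.2.2, by omega, hnr.2⟩
  | _ => exact hD.elim

/-- An injective map onto a successor-closed part of an interpretation preserves and reflects
concepts without inverse roles. -/
theorem mem_sem_iff_of_embedding {SC SR : Finset ℕ} {I J : Interp} (f : I.Δ ↪ J.Δ)
    (hatom : ∀ A d, f d ∈ J.atom A ↔ d ∈ I.atom A)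
    (hrel : ∀ R d e, J.rel R (f d) e ↔ ∃ e', I.rel R d e' ∧ f e' = e)
    {C : Concept} (hC : C.inLang aleqOps SC SR) (d : I.Δ) :
    f d ∈ C.sem J ↔ d ∈ C.sem I := by
  revert d
  refine Concept.inLang_induction (P := fun C => ∀ d, f d ∈ C.sem J ↔ d ∈ C.sem I)
    ?_ ?_ ?_ ?_ ?_ ?_ C hC
  · intro A _ d
    exact hatom A d
  · intro d
    exact Iff.rfl
  · intro C D _ _ ihC ihD d
    exact and_congr (ihC d) (ihD d)
  · intro R C _ _ ih d
    constructor
    · rintro ⟨e, hde, he⟩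
      obtain ⟨e', hde', rfl⟩ := (hrel R d e).1 hde
      exact ⟨e', hde', (ih e').1 he⟩
    · rintro ⟨e, hde, he⟩
      exact ⟨f e, (hrel R d _).2 ⟨e, hde, rfl⟩, (ih e).2 he⟩
  · intro R C _ _ ih d
    constructor
    · intro h e hde
      exact (ih e).1 (h (f e) ((hrel R d _).2 ⟨e, hde, rfl⟩))
    · intro h e hde
      obtain ⟨e', hde', rfl⟩ := (hrel R d e).1 hde
      exact (ih e').2 (h e' hde')
  · intro k R C _ _ _ ih d
    constructor
    · rintro ⟨s, hs, h⟩
      refine ⟨s.preimage f f.injective.injOn, ?_, ?_⟩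
      · rw [← hs, ← Finset.card_map f]
        congr 1
        ext e
        simp only [Finset.mem_map, Finset.mem_preimage]
        constructor
        · rintro ⟨e', he', rfl⟩
          exact he'
        · intro he
          obtain ⟨e', -, rfl⟩ := (hrel R d e).1 (h e he).1
          exact ⟨e', he, rfl⟩
      · intro e he
        obtain ⟨hde, heC⟩ := h (f e) (Finset.mem_preimage.1 he)
        obtain ⟨e', hde', he'⟩ := (hrel R d _).1 hde
        exact ⟨f.injective he' ▸ hde', (ih e).1 heC⟩
    · rintro ⟨s, hs, h⟩
      refine ⟨s.map f, by rw [Finset.card_map, hs], ?_⟩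
      intro e he
      obtain ⟨e', he', rfl⟩ := Finset.mem_map.1 he
      exact ⟨(hrel R d _).2 ⟨e', (h e' he').1, rfl⟩, (ih e').2 (h e' he').2⟩

section Layer

variable (SC SR : Finset ℕ) (N : ℕ)

/-- The interpretation consisting of `N` disjoint copies of `J` together with, for every set of
concept names and every choice of successor sets within the copies, one new element. -/
def layer (J : Interp) : Interp where
  Δ := (Set SC × (SR → Set (J.Δ × Fin N))) ⊕ (J.Δ × Fin N)
  dom_nonempty := ⟨.inl (∅, fun _ => ∅)⟩
  atom A := {p | match p with
    | .inl r => ∃ h : A ∈ SC, ⟨A, h⟩ ∈ r.1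
    | .inr q => q.1 ∈ J.atom A}
  rel R p p' := match p, p' with
    | .inl r, .inr q => ∃ h : R ∈ SR, q ∈ r.2 ⟨R, h⟩
    | .inr q, .inr q' => J.rel R q.1 q'.1 ∧ q.2 = q'.2
    | _, .inl _ => False

/-- Two points: one without successors, and one that sees both points along every role. No
concept name holds anywhere. -/
def seed : Interp where
  Δ := Bool
  dom_nonempty := ⟨true⟩
  atom _ := ∅
  rel _ p _ := p = true

/-- The iterated layers over `seed`. -/
def tower : ℕ → Interp
  | 0 => layer SC SR N seed
  | n + 1 => layer SC SR N (tower n)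

variable {SC SR N}

/-- A new element of a layer. -/
abbrev layerRoot {J : Interp} (a : Set SC) (s : SR → Set (J.Δ × Fin N)) : (layer SC SR N J).Δ :=
  .inl (a, s)

/-- An element of one of the copies of `J` in a layer over `J`. -/
abbrev layerCopy {J : Interp} (q : J.Δ × Fin N) : (layer SC SR N J).Δ := .inr q

theorem rel_layerRoot {J : Interp} {a : Set SC} {s : SR → Set (J.Δ × Fin N)} {R : ℕ}
    (hR : R ∈ SR) {p : (layer SC SR N J).Δ} :
    (layer SC SR N J).rel R (layerRoot a s) p ↔ ∃ q ∈ s ⟨R, hR⟩, layerCopy q = p := by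
  rcases p with r | q
  · constructor
    · exact False.elim
    · rintro ⟨q, -, h⟩
      cases h
  · constructor
    · rintro ⟨_, h⟩
      exact ⟨q, h, rfl⟩
    · rintro ⟨q', h, h'⟩
      cases h'
      exact ⟨hR, h⟩

theorem finite_layer {J : Interp} [Finite J.Δ] : Finite (layer SC SR N J).Δ :=
  inferInstanceAs (Finite ((Set SC × (SR → Set (J.Δ × Fin N))) ⊕ (J.Δ × Fin N)))

instance finite_tower (n : ℕ) : Finite (tower SC SR N n).Δ := by
  induction n with
  | zero =>
    have : Finite seed.Δ := inferInstanceAs (Finite Bool)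
    exact finite_layer
  | succ n ih => exact finite_layer

theorem layerCopy_mem_sem {J : Interp} {C : Concept} (hC : C.inLang aleqOps SC SR)
    (q : J.Δ × Fin N) : layerCopy q ∈ C.sem (layer SC SR N J) ↔ q.1 ∈ C.sem J := by
  obtain ⟨d, i⟩ := q
  refine mem_sem_iff_of_embedding (I := J) (J := layer SC SR N J)
    ⟨fun d => layerCopy (d, i), fun d e h => ?_⟩ (fun A d => Iff.rfl) ?_ hC d
  · cases h
    rfl
  · intro R d p
    rcases p with r | ⟨e, j⟩
    · constructor
      · exact False.elim
      · rintro ⟨e, -, h⟩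
        cases h
    · constructor
      · rintro ⟨h, h'⟩
        cases h'
        exact ⟨e, h, rfl⟩
      · rintro ⟨e, h, h'⟩
        cases h'
        exact ⟨h, rfl⟩

theorem layerRoot_mem_ex {J : Interp} {a : Set SC} {s : SR → Set (J.Δ × Fin N)} {R : ℕ}
    (hR : R ∈ SR) {C : Concept} (hC : C.inLang aleqOps SC SR) :
    layerRoot a s ∈ (Concept.ex (.name R) C).sem (layer SC SR N J) ↔
      ∃ q ∈ s ⟨R, hR⟩, q.1 ∈ C.sem J := by
  constructor
  · rintro ⟨p, hp, hpC⟩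
    obtain ⟨q, hq, rfl⟩ := (rel_layerRoot hR).1 hp
    exact ⟨q, hq, (layerCopy_mem_sem hC q).1 hpC⟩
  · rintro ⟨q, hq, hqC⟩
    exact ⟨layerCopy q, (rel_layerRoot hR).2 ⟨q, hq, rfl⟩, (layerCopy_mem_sem hC q).2 hqC⟩

theorem layerRoot_mem_all {J : Interp} {a : Set SC} {s : SR → Set (J.Δ × Fin N)} {R : ℕ}
    (hR : R ∈ SR) {C : Concept} (hC : C.inLang aleqOps SC SR) :
    layerRoot a s ∈ (Concept.all (.name R) C).sem (layer SC SR N J) ↔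
      ∀ q ∈ s ⟨R, hR⟩, q.1 ∈ C.sem J := by
  constructor
  · intro h q hq
    exact (layerCopy_mem_sem hC q).1 (h _ ((rel_layerRoot hR).2 ⟨q, hq, rfl⟩))
  · intro h p hp
    obtain ⟨q, hq, rfl⟩ := (rel_layerRoot hR).1 hp
    exact (layerCopy_mem_sem hC q).2 (h q hq)

theorem layerRoot_mem_atLeast {J : Interp} {a : Set SC} {s : SR → Set (J.Δ × Fin N)} {k R : ℕ}
    (hR : R ∈ SR) {C : Concept} (hC : C.inLang aleqOps SC SR) :
    layerRoot a s ∈ (Concept.atLeast k (.name R) C).sem (layer SC SR N J) ↔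
      ∃ t : Finset (J.Δ × Fin N), t.card = k ∧ ∀ q ∈ t, q ∈ s ⟨R, hR⟩ ∧ q.1 ∈ C.sem J := by
  let f : J.Δ × Fin N ↪ (layer SC SR N J).Δ := ⟨layerCopy, Sum.inr_injective⟩
  constructor
  · rintro ⟨t, ht, h⟩
    refine ⟨t.preimage f f.injective.injOn, ?_, ?_⟩
    · rw [← ht, ← Finset.card_map f]
      congr 1
      ext p
      simp only [Finset.mem_map, Finset.mem_preimage]
      constructor
      · rintro ⟨q, hq, rfl⟩
        exact hq
      · intro hp
        obtain ⟨q, -, rfl⟩ := (rel_layerRoot hR).1 (h p hp).1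
        exact ⟨q, hp, rfl⟩
    · intro q hq
      obtain ⟨h₁, h₂⟩ := h (f q) (Finset.mem_preimage.1 hq)
      obtain ⟨q', hq', hqq⟩ := (rel_layerRoot hR).1 h₁
      cases hqq
      exact ⟨hq', (layerCopy_mem_sem hC q).1 h₂⟩
  · rintro ⟨t, ht, h⟩
    refine ⟨t.map f, by rw [Finset.card_map, ht], ?_⟩
    intro p hp
    obtain ⟨q, hq, rfl⟩ := Finset.mem_map.1 hp
    exact ⟨(rel_layerRoot hR).2 ⟨q, (h q hq).1, rfl⟩, (layerCopy_mem_sem hC q).2 (h q hq).2⟩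

/-- A sufficient condition for a new element of a layer to satisfy a concept. -/
theorem layerRoot_mem_sem {J : Interp} (hN : 1 ≤ N) {s : SR → Set (J.Δ × Fin N)}
    {C : Concept} (hC : C.inLang aleqOps SC SR) (hnr : C.nr ≤ N)
    (hall : ∀ R, ∀ q ∈ s R, q.1 ∈ (C.forallPart R).sem J)
    (hex : ∀ R : SR, ∀ D ∈ C.existsParts R, ∃ d ∈ D.sem J, ∀ i, (d, i) ∈ s R) :
    layerRoot Set.univ s ∈ C.sem (layer SC SR N J) := by
  revert hnr hall hex
  refine Concept.inLang_induction (P := fun C => C.nr ≤ N →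
    (∀ R, ∀ q ∈ s R, q.1 ∈ (C.forallPart R).sem J) →
    (∀ R : SR, ∀ D ∈ C.existsParts R, ∃ d ∈ D.sem J, ∀ i, (d, i) ∈ s R) →
    layerRoot Set.univ s ∈ C.sem (layer SC SR N J)) ?_ ?_ ?_ ?_ ?_ ?_ C hC
  · intro A hA _ _ _
    exact ⟨hA, trivial⟩
  · intro _ _ _
    trivial
  · intro C D _ _ ihC ihD hnr hall hex
    simp only [Concept.nr, max_le_iff] at hnr
    exact ⟨ihC hnr.1 (fun R q hq => (hall R q hq).1) (fun R E hE => hex R E (.inl hE)),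
      ihD hnr.2 (fun R q hq => (hall R q hq).2) (fun R E hE => hex R E (.inr hE))⟩
  · intro R C hR hC _ _ _ hex
    obtain ⟨d, hd, h⟩ := hex ⟨R, hR⟩ C ⟨rfl, rfl⟩
    exact (layerRoot_mem_ex hR hC).2 ⟨(d, ⟨0, hN⟩), h _, hd⟩
  · intro R C hR hC _ _ hall _
    refine (layerRoot_mem_all hR hC).2 fun q hq => ?_
    simpa [Concept.forallPart] using hall ⟨R, hR⟩ q hq
  · intro k R C _ hR hC _ hnr _ hex
    obtain ⟨d, hd, h⟩ := hex ⟨R, hR⟩ C ⟨rfl, rfl⟩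
    have hk : k ≤ (Finset.univ : Finset (Fin N)).card := by
      simpa using (le_max_left k C.nr).trans hnr
    obtain ⟨t, -, ht⟩ := Finset.exists_subset_card_eq hk
    refine (layerRoot_mem_atLeast hR hC).2
      ⟨t.map ⟨fun i => (d, i), fun i j hij => (Prod.mk.inj hij).2⟩, by simpa using ht, ?_⟩
    intro q hq
    obtain ⟨i, -, rfl⟩ := Finset.mem_map.1 hq
    exact ⟨h i, hd⟩

end Layer

section BoundedEquivalents

variable {SC SR : Finset ℕ} {N : ℕ}

theorem mem_sem_of_mem_seed {C : Concept} (hC : C.inLang aleqOps SC SR)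
    (h : ∀ b, b ∈ C.sem seed) (I : Interp) (d : I.Δ) : d ∈ C.sem I := by
  revert h I
  refine Concept.inLang_induction (P := fun C => (∀ b, b ∈ C.sem seed) →
    ∀ (I : Interp) (d : I.Δ), d ∈ C.sem I) ?_ ?_ ?_ ?_ ?_ ?_ C hC
  · intro A _ h
    exact (h true).elim
  · intro _ I d
    trivial
  · intro C D _ _ ihC ihD h I d
    exact ⟨ihC (fun b => (h b).1) I d, ihD (fun b => (h b).2) I d⟩
  · intro R C _ _ _ h
    obtain ⟨e, he, -⟩ := h false
    cases he
  · intro R C _ _ ih h I d e _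
    exact ih (fun b => h true b rfl) I e
  · intro k R C hk _ _ _ h
    obtain ⟨t, ht, h'⟩ := h false
    obtain ⟨e, he⟩ := Finset.card_pos.1 (by omega : 0 < t.card)
    cases (h' e he).1

/-- `D` is equivalent to a concept of the language of role depth at most `n` and with numbers
at most `M`. -/
def HasBoundedEquiv (SC SR : Finset ℕ) (n M : ℕ) (D : Concept) : Prop :=
  ∃ D' : Concept, D'.inLang aleqOps SC SR ∧ D'.dp ≤ n ∧ D'.nr ≤ M ∧ CEquiv D D'

theorem HasBoundedEquiv.and {n M : ℕ} {C D : Concept} (hC : HasBoundedEquiv SC SR n M C)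
    (hD : HasBoundedEquiv SC SR n M D) : HasBoundedEquiv SC SR n M (.and C D) := by
  obtain ⟨C', hC₁, hC₂, hC₃, hC₄⟩ := hC
  obtain ⟨D', hD₁, hD₂, hD₃, hD₄⟩ := hD
  exact ⟨.and C' D', ⟨by simp, hC₁, hD₁⟩, max_le hC₂ hD₂, max_le hC₃ hD₃,
    fun I => by simp only [Concept.sem, hC₄ I, hD₄ I]⟩

theorem HasBoundedEquiv.ex {n M R : ℕ} (hR : R ∈ SR) {D : Concept}
    (hD : HasBoundedEquiv SC SR n M D) : HasBoundedEquiv SC SR (n + 1) M (.ex (.name R) D) := by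
  obtain ⟨D', hD₁, hD₂, hD₃, hD₄⟩ := hD
  exact ⟨.ex (.name R) D', ⟨by simp, hR, hD₁⟩, Nat.succ_le_succ hD₂, hD₃,
    fun I => by simp only [Concept.sem, hD₄ I]⟩

theorem HasBoundedEquiv.all {n M R : ℕ} (hR : R ∈ SR) {D : Concept}
    (hD : HasBoundedEquiv SC SR n M D) : HasBoundedEquiv SC SR (n + 1) M (.all (.name R) D) := by
  obtain ⟨D', hD₁, hD₂, hD₃, hD₄⟩ := hD
  exact ⟨.all (.name R) D', ⟨by simp, hR, hD₁⟩, Nat.succ_le_succ hD₂, hD₃,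
    fun I => by simp only [Concept.sem, hD₄ I]⟩

theorem HasBoundedEquiv.atLeast {n M k R : ℕ} (hR : R ∈ SR) (hk : 1 ≤ k) (hkM : k ≤ M)
    {D : Concept} (hD : HasBoundedEquiv SC SR n M D) :
    HasBoundedEquiv SC SR (n + 1) M (.atLeast k (.name R) D) := by
  obtain ⟨D', hD₁, hD₂, hD₃, hD₄⟩ := hD
  exact ⟨.atLeast k (.name R) D', ⟨by simp, hk, hR, hD₁⟩, Nat.succ_le_succ hD₂, max_le hkM hD₃,
    fun I => by simp only [Concept.sem, hD₄ I]⟩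

/-- Every concept of role depth at most `n` with numbers at most `N` is satisfied in `J` outside
`X`. -/
def AvoidableIn (SC SR : Finset ℕ) (n N : ℕ) (J : Interp) (X : Set J.Δ) : Prop :=
  ∀ C : Concept, C.inLang aleqOps SC SR → C.dp ≤ n → C.nr ≤ N → ∃ p ∈ C.sem J, p ∉ X

theorem AvoidableIn.mono {n : ℕ} {J : Interp} {X Y : Set J.Δ} (h : AvoidableIn SC SR n N J Y)
    (hXY : X ⊆ Y) : AvoidableIn SC SR n N J X := fun C hC hdp hnr =>
  let ⟨p, hp, hpY⟩ := h C hC hdp hnr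
  ⟨p, hp, fun hpX => hpY (hXY hpX)⟩

theorem AvoidableIn.exists_layerRoot {n : ℕ} {J : Interp} {X : Set J.Δ} (hN : 1 ≤ N)
    (hX : AvoidableIn SC SR n N J X) {C : Concept} (hC : C.inLang aleqOps SC SR)
    (hdp : C.dp ≤ n + 1) (hnr : C.nr ≤ N) :
    ∃ s : SR → Set (J.Δ × Fin N), layerRoot Set.univ s ∈ C.sem (layer SC SR N J) ∧
      ∀ R, (s R).Nonempty ∧ ∀ q ∈ s R, q.1 ∉ X := by
  refine ⟨fun R => {q | q.1 ∈ (C.forallPart R).sem J ∧ q.1 ∉ X},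
    layerRoot_mem_sem hN hC hnr (fun R q hq => hq.1) ?_, fun R => ⟨?_, fun q hq => hq.2⟩⟩
  · intro R D hD
    obtain ⟨h₁, h₂, h₃⟩ := Concept.forallPart_bounds R hC hdp hnr
    obtain ⟨h₁', h₂', h₃'⟩ := Concept.existsParts_bounds hC hdp hnr hD
    obtain ⟨d, hd, hdX⟩ := hX (.and D (C.forallPart R)) ⟨by simp, h₁', h₁⟩ (max_le h₂' h₂)
      (max_le h₃' h₃)
    exact ⟨d, hd.1, fun i => ⟨hd.2, hdX⟩⟩
  · obtain ⟨h₁, h₂, h₃⟩ := Concept.forallPart_bounds R hC hdp hnr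
    obtain ⟨d, hd, hdX⟩ := hX _ h₁ h₂ h₃
    exact ⟨(d, ⟨0, hN⟩), hd, hdX⟩

theorem layerRoot_mem_sem_of_dp_eq_zero {J : Interp} (s : SR → Set (J.Δ × Fin N))
    {C : Concept} (hC : C.inLang aleqOps SC SR) (hdp : C.dp ≤ 0) :
    layerRoot Set.univ s ∈ C.sem (layer SC SR N J) := by
  induction C with
  | atom A => exact ⟨hC, trivial⟩
  | top => trivial
  | and C D ihC ihD =>
    simp only [Concept.dp, max_le_iff] at hdp
    exact ⟨ihC hC.2.1 hdp.1, ihD hC.2.2 hdp.2⟩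
  | _ => simp [Concept.inLang, Concept.dp] at hC hdp

theorem avoidableIn_tower_empty (hN : 1 ≤ N) (n : ℕ) :
    AvoidableIn SC SR n N (tower SC SR N n) ∅ := by
  induction n with
  | zero => exact fun C hC hdp _ =>
      ⟨_, layerRoot_mem_sem_of_dp_eq_zero (fun _ => ∅) hC hdp, Set.notMem_empty _⟩
  | succ n ih => exact fun C hC hdp hnr =>
      let ⟨_, hs, _⟩ := ih.exists_layerRoot hN hC hdp hnr
      ⟨_, hs, Set.notMem_empty _⟩

/-- A concept of the language without an equivalent of bounded role depth and bounded numbers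
does not follow from any concept of that role depth, as witnessed in the tower. -/
theorem hasBoundedEquiv_or_avoidableIn (hN : 1 ≤ N) (n M : ℕ)
    (hM : Nat.card (tower SC SR N n).Δ ≤ M) {D : Concept} (hD : D.inLang aleqOps SC SR) :
    HasBoundedEquiv SC SR n M D ∨
      AvoidableIn SC SR n N (tower SC SR N n) (D.sem (tower SC SR N n)) := by
  induction n generalizing D with
  | zero =>
    refine Concept.inLang_induction (P := fun D => HasBoundedEquiv SC SR 0 M D ∨
      AvoidableIn SC SR 0 N (tower SC SR N 0) (D.sem (tower SC SR N 0))) ?_ ?_ ?_ ?_ ?_ ?_ D hD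
    · intro A hA
      exact .inl ⟨.atom A, hA, le_rfl, Nat.zero_le _, fun _ => rfl⟩
    · exact .inl ⟨.top, by simp [Concept.inLang], le_rfl, Nat.zero_le _, fun _ => rfl⟩
    · rintro C D - - (hC | hC) (hD | hD)
      · exact .inl (hC.and hD)
      · exact .inr (hD.mono Set.inter_subset_right)
      · exact .inr (hC.mono Set.inter_subset_left)
      · exact .inr (hC.mono Set.inter_subset_left)
    · intro R E hR hE _
      refine .inr fun C hC hdp _ =>
        ⟨_, layerRoot_mem_sem_of_dp_eq_zero (fun _ => ∅) hC hdp, fun h => ?_⟩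
      obtain ⟨q, hq, -⟩ := (layerRoot_mem_ex hR hE).1 h
      exact hq
    · intro R E hR hE _
      by_cases h : ∀ b, b ∈ E.sem seed
      · refine .inl ⟨.top, by simp [Concept.inLang], le_rfl, Nat.zero_le _, fun I => ?_⟩
        exact Set.eq_univ_of_forall fun d e _ => mem_sem_of_mem_seed hE h I e
      · push Not at h
        obtain ⟨b, hb⟩ := h
        refine .inr fun C hC hdp _ =>
          ⟨_, layerRoot_mem_sem_of_dp_eq_zero (fun _ => Set.univ) hC hdp, fun h => hb ?_⟩
        exact (layerRoot_mem_all hR hE).1 h (b, ⟨0, hN⟩) trivial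
    · intro k R E hk hR hE _
      refine .inr fun C hC hdp _ =>
        ⟨_, layerRoot_mem_sem_of_dp_eq_zero (fun _ => ∅) hC hdp, fun h => ?_⟩
      obtain ⟨t, ht, h'⟩ := (layerRoot_mem_atLeast hR hE).1 h
      obtain ⟨q, hq⟩ := Finset.card_pos.1 (by omega : 0 < t.card)
      exact (h' q hq).1
  | succ n ih =>
    have hM' : Nat.card (tower SC SR N n).Δ ≤ M := by
      refine le_trans (Nat.card_le_card_of_injective (β := (tower SC SR N (n + 1)).Δ)
        (fun d => layerCopy (d, ⟨0, hN⟩)) fun d e h => ?_) hM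
      cases h
      rfl
    replace ih := fun {E : Concept} => ih hM' (D := E)
    refine Concept.inLang_induction (P := fun D => HasBoundedEquiv SC SR (n + 1) M D ∨
      AvoidableIn SC SR (n + 1) N (tower SC SR N (n + 1)) (D.sem (tower SC SR N (n + 1))))
      ?_ ?_ ?_ ?_ ?_ ?_ D hD
    · intro A hA
      exact .inl ⟨.atom A, hA, Nat.zero_le _, Nat.zero_le _, fun _ => rfl⟩
    · exact .inl ⟨.top, by simp [Concept.inLang], Nat.zero_le _, Nat.zero_le _, fun _ => rfl⟩
    · rintro C D - - (hC | hC) (hD | hD)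
      · exact .inl (hC.and hD)
      · exact .inr (hD.mono Set.inter_subset_right)
      · exact .inr (hC.mono Set.inter_subset_left)
      · exact .inr (hC.mono Set.inter_subset_left)
    · intro R E hR hE _
      refine (ih hE).imp (.ex hR) fun hX C hC hdp hnr => ?_
      obtain ⟨s, hs, h⟩ := hX.exists_layerRoot hN hC hdp hnr
      refine ⟨_, hs, fun h' => ?_⟩
      obtain ⟨q, hq, hqE⟩ := (layerRoot_mem_ex hR hE).1 h'
      exact (h _).2 q hq hqE
    · intro R E hR hE _
      refine (ih hE).imp (.all hR) fun hX C hC hdp hnr => ?_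
      obtain ⟨s, hs, h⟩ := hX.exists_layerRoot hN hC hdp hnr
      refine ⟨_, hs, fun h' => ?_⟩
      obtain ⟨q, hq⟩ := (h ⟨R, hR⟩).1
      exact (h _).2 q hq ((layerRoot_mem_all hR hE).1 h' q hq)
    · intro k R E hk hR hE _
      by_cases hkM : k ≤ M
      · refine (ih hE).imp (.atLeast hR hk hkM) fun hX C hC hdp hnr => ?_
        obtain ⟨s, hs, h⟩ := hX.exists_layerRoot hN hC hdp hnr
        refine ⟨_, hs, fun h' => ?_⟩
        obtain ⟨t, ht, ht'⟩ := (layerRoot_mem_atLeast hR hE).1 h'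
        obtain ⟨q, hq⟩ := Finset.card_pos.1 (by omega : 0 < t.card)
        exact (h _).2 q (ht' q hq).1 (ht' q hq).2
      · refine .inr ((avoidableIn_tower_empty hN (n + 1)).mono ?_)
        rintro p ⟨t, ht, -⟩
        have := Nat.card_le_card_of_injective (α := t) _ Subtype.val_injective
        rw [Nat.card_eq_finsetCard] at this
        omega

end BoundedEquivalents

section Universality

variable {SC SR : Finset ℕ} {N : ℕ}

/-- The element representing `d` in a layer over `J`, where `f` represents the successors of `d`
in `J`: every element of `J` occurs as often (up to `N` times) as it represents a successor. -/
def represent {J : Interp} (I : Interp) (f : I.Δ → J.Δ) (d : I.Δ) : (layer SC SR N J).Δ :=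
  layerRoot {A | d ∈ I.atom A} fun R => {q | ∃ t : Finset I.Δ, q.2 < t.card ∧
    ∀ e ∈ t, I.rel R d e ∧ f e = q.1}

theorem represent_mem_atLeast {I J : Interp} {f : I.Δ → J.Δ} {d : I.Δ} {k R : ℕ} (hk : k ≤ N)
    (hR : R ∈ SR) {C : Concept} (hC : C.inLang aleqOps SC SR)
    (hf : ∀ e, f e ∈ C.sem J ↔ e ∈ C.sem I) :
    represent I f d ∈ (Concept.atLeast k (.name R) C).sem (layer SC SR N J) ↔
      d ∈ (Concept.atLeast k (.name R) C).sem I := by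
  classical
  rw [represent, layerRoot_mem_atLeast hR hC]
  constructor
  · rintro ⟨t, ht, h⟩
    have key : ∀ q ∈ t.image Prod.fst, ∃ u : Finset I.Δ,
        (t.filter fun p => p.1 = q).card ≤ u.card ∧ ∀ e ∈ u, I.rel R d e ∧ f e = q := by
      intro q hq
      set F := (t.filter fun p => p.1 = q).image Prod.snd with hF
      have hcard : (t.filter fun p => p.1 = q).card = F.card := by
        refine (Finset.card_image_of_injOn ?_).symm
        intro x hx y hy hxy
        simp only [Finset.coe_filter, Set.mem_ofPred_eq] at hx hy
        exact Prod.ext (hx.2.trans hy.2.symm) hxy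
      have hne : F.Nonempty := by
        obtain ⟨p, hp, rfl⟩ := Finset.mem_image.1 hq
        exact ⟨p.2, Finset.mem_image_of_mem _ (Finset.mem_filter.2 ⟨hp, rfl⟩)⟩
      obtain ⟨p, hp, hpm⟩ := Finset.mem_image.1 (F.max'_mem hne)
      obtain ⟨hpt, rfl⟩ := Finset.mem_filter.1 hp
      obtain ⟨u, hu, hu'⟩ := (h p hpt).1
      refine ⟨u, ?_, hu'⟩
      rw [hcard]
      have hsub : F ⊆ Finset.Iic (F.max' hne) := fun i hi => Finset.mem_Iic.2 (F.le_max' i hi)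
      have := Finset.card_le_card hsub
      rw [Fin.card_Iic, ← hpm] at this
      omega
    choose! u hu hu' using key
    have hdisj : ((t.image Prod.fst : Finset J.Δ) : Set J.Δ).PairwiseDisjoint u := by
      intro x hx y hy hxy
      refine Finset.disjoint_left.2 fun e hex hey => hxy ?_
      rw [← (hu' x hx e hex).2, ← (hu' y hy e hey).2]
    have hle : k ≤ ((t.image Prod.fst).biUnion u).card := by
      rw [Finset.card_biUnion hdisj, ← ht, Finset.card_eq_sum_card_image Prod.fst t]
      exact Finset.sum_le_sum hu
    obtain ⟨v, hv, hvk⟩ := Finset.exists_subset_card_eq hle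
    refine ⟨v, hvk, fun e he => ?_⟩
    obtain ⟨q, hq, heq⟩ := Finset.mem_biUnion.1 (hv he)
    obtain ⟨hde, rfl⟩ := hu' q hq e heq
    obtain ⟨p, hp, hpq⟩ := Finset.mem_image.1 hq
    exact ⟨hde, (hf e).1 (hpq ▸ (h p hp).2)⟩
  · rintro ⟨t, ht, h⟩
    let m : J.Δ → ℕ := fun q => (t.filter fun e => f e = q).card
    have hm : ∀ q, m q ≤ N := fun q => (Finset.card_filter_le _ _).trans (ht.trans_le hk)
    let T := (t.image f).sigma fun q => (Finset.univ : Finset (Fin (m q)))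
    have hinj : Function.Injective
        fun x : (Σ q, Fin (m q)) => ((x.1, Fin.castLE (hm x.1) x.2) : J.Δ × Fin N) := by
      rintro ⟨x, i⟩ ⟨y, j⟩ hxy
      simp only [Prod.mk.injEq] at hxy
      obtain ⟨rfl, hij⟩ := hxy
      rw [Fin.castLE_inj] at hij
      rw [hij]
    refine ⟨T.map ⟨_, hinj⟩, ?_, ?_⟩
    · rw [Finset.card_map, Finset.card_sigma, ← ht, Finset.card_eq_sum_card_image f t]
      simp [m]
    · intro p hp
      obtain ⟨⟨q, i⟩, hqi, rfl⟩ := Finset.mem_map.1 hp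
      obtain ⟨e, he, rfl⟩ := Finset.mem_image.1 (Finset.mem_sigma.1 hqi).1
      refine ⟨⟨t.filter fun e' => f e' = f e, i.2, fun e' he' => ?_⟩, (hf e).2 (h e he).2⟩
      obtain ⟨he't, he'e⟩ := Finset.mem_filter.1 he'
      exact ⟨(h e' he't).1, he'e⟩

theorem represent_mem_sem {n : ℕ} {I J : Interp} (hN : 1 ≤ N) {f : I.Δ → J.Δ}
    (hf : ∀ C : Concept, C.inLang aleqOps SC SR → C.dp + 1 ≤ n → C.nr ≤ N →
      ∀ e, f e ∈ C.sem J ↔ e ∈ C.sem I)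
    {C : Concept} (hC : C.inLang aleqOps SC SR) (hdp : C.dp ≤ n) (hnr : C.nr ≤ N) (d : I.Δ) :
    represent I f d ∈ C.sem (layer SC SR N J) ↔ d ∈ C.sem I := by
  revert hdp hnr
  refine Concept.inLang_induction (P := fun C => C.dp ≤ n → C.nr ≤ N →
    (represent I f d ∈ C.sem (layer SC SR N J) ↔ d ∈ C.sem I)) ?_ ?_ ?_ ?_ ?_ ?_ C hC
  · intro A hA _ _
    exact ⟨fun ⟨_, h⟩ => h, fun h => ⟨hA, h⟩⟩
  · intro _ _
    exact Iff.rfl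
  · intro C D _ _ ihC ihD hdp hnr
    simp only [Concept.dp, Concept.nr, max_le_iff] at hdp hnr
    exact and_congr (ihC hdp.1 hnr.1) (ihD hdp.2 hnr.2)
  · intro R C hR hC _ hdp hnr
    rw [represent, layerRoot_mem_ex hR hC]
    constructor
    · rintro ⟨q, ⟨t, ht, h⟩, hq⟩
      obtain ⟨e, he⟩ := Finset.card_pos.1 (Nat.zero_lt_of_lt ht)
      exact ⟨e, (h e he).1, (hf C hC hdp hnr e).1 ((h e he).2 ▸ hq)⟩
    · rintro ⟨e, hde, he⟩
      exact ⟨(f e, ⟨0, hN⟩), ⟨{e}, by simp, by simpa using show I.rel R d e from hde⟩, (hf C hC hdp hnr e).2 he⟩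
  · intro R C hR hC _ hdp hnr
    rw [represent, layerRoot_mem_all hR hC]
    constructor
    · intro h e hde
      exact (hf C hC hdp hnr e).1 (h (f e, ⟨0, hN⟩) ⟨{e}, by simp, by simpa using show I.rel R d e from hde⟩)
    · rintro h q ⟨t, ht, h'⟩
      obtain ⟨e, he⟩ := Finset.card_pos.1 (Nat.zero_lt_of_lt ht)
      exact (h' e he).2 ▸ (hf C hC hdp hnr e).2 (h e (h' e he).1)
  · intro k R C _ hR hC _ hdp hnr
    simp only [Concept.nr, max_le_iff] at hnr
    exact represent_mem_atLeast hnr.1 hR hC (hf C hC hdp hnr.2)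

/-- Every pointed interpretation is indistinguishable from a point of the tower by concepts of
bounded role depth and bounded numbers. -/
theorem exists_tower_indistinguishable (hN : 1 ≤ N) (n : ℕ) (I : Interp) :
    ∃ f : I.Δ → (tower SC SR N n).Δ, ∀ C : Concept, C.inLang aleqOps SC SR → C.dp ≤ n →
      C.nr ≤ N → ∀ d, f d ∈ C.sem (tower SC SR N n) ↔ d ∈ C.sem I := by
  induction n with
  | zero => exact ⟨represent I fun _ => (true : Bool), fun C hC hdp hnr d =>
      represent_mem_sem hN (n := 0) (fun _ _ h => by omega) hC hdp hnr d⟩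
  | succ n ih =>
    obtain ⟨f, hf⟩ := ih
    exact ⟨represent I f, fun C hC hdp hnr d => represent_mem_sem hN (n := n + 1)
      (fun E hE hEdp => hf E hE (by omega)) hC hdp hnr d⟩

end Universality

theorem exists_list_points (I : Interp) [Finite I.Δ] (S : Set I.Δ) :
    ∃ l : List PInterp, ∀ e, e ∈ l ↔ ∃ p ∈ S, e = ⟨I, p⟩ := by
  refine ⟨S.toFinite.toFinset.toList.map fun p => ⟨I, p⟩, fun e => ?_⟩
  simp [eq_comm]

/-- **Theorem**: `L(∀,∃,≥,⊓,⊤)` admits finite characterisations. -/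
theorem ALEQ_admits_finite_characterisations :
    AdmitsFinChar ({Op.all, Op.ex, Op.ge, Op.and, Op.top} : Finset Op) := by
  intro SC SR C hC
  let n := C.dp
  let N := max 1 C.nr
  have hN : 1 ≤ N := le_max_left _ _
  let J := tower SC SR N n
  let M := max N (Nat.card J.Δ)
  have hNM : N ≤ M := le_max_left _ _
  let K := tower SC SR M n
  obtain ⟨l₁, h₁⟩ := exists_list_points J (C.sem J)
  obtain ⟨l₂, h₂⟩ := exists_list_points K (C.sem K)
  obtain ⟨l₃, h₃⟩ := exists_list_points K (C.sem K)ᶜ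
  refine ⟨l₁ ++ l₂, l₃, ?_, ⟨?_, ?_⟩, ?_⟩
  · intro e he
    simp only [List.mem_append, h₁, h₂, h₃] at he
    rcases he with (⟨p, -, rfl⟩ | ⟨p, -, rfl⟩) | ⟨p, -, rfl⟩
    exacts [finite_tower n, finite_tower n, finite_tower n]
  · intro e he
    simp only [List.mem_append, h₁, h₂] at he
    rcases he with ⟨p, hp, rfl⟩ | ⟨p, hp, rfl⟩ <;> exact hp
  · intro e he
    obtain ⟨p, hp, rfl⟩ := (h₃ e).1 he
    exact hp
  · rintro D hD ⟨hpos, hneg⟩ I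
    have hK : ∀ p, p ∈ C.sem K ↔ p ∈ D.sem K := fun p =>
      ⟨fun hp => hpos ⟨K, p⟩ (List.mem_append_right _ ((h₂ _).2 ⟨p, hp, rfl⟩)), fun hp => by
        by_contra hpC
        exact hneg ⟨K, p⟩ ((h₃ _).2 ⟨p, hpC, rfl⟩) hp⟩
    rcases hasBoundedEquiv_or_avoidableIn hN n M (le_max_right _ _) hD with h | h
    · obtain ⟨D', hD', hdp, hnr, hDD'⟩ := h
      obtain ⟨f, hf⟩ := exists_tower_indistinguishable (SC := SC) (SR := SR) (hN.trans hNM) n I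
      ext d
      rw [← hf C hC le_rfl ((le_max_right _ _).trans hNM) d, hDD' I, ← hf D' hD' hdp hnr d,
        ← hDD' _]
      exact hK _
    · obtain ⟨p, hp, hpD⟩ := h C hC le_rfl (le_max_right _ _)
      exact absurd (hpos ⟨J, p⟩ (List.mem_append_left _ ((h₁ _).2 ⟨p, hp, rfl⟩))) hpD

end DL
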